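/- There is a constant K > 0 such that for every integer m ≥ 2, | |F_{1/m}| − ( (3/π²)·m·(ln m + 1 + 2γ) − A·m + 2 ) | ≤ K·m, where γ is the Euler–Mascheroni constant and A = Σ_{n=1}^{∞} μ(n)·ln(n)/n²; that is, |F_{1/m}| = (m/(2ζ(2)))·(ln m + 1 + 2γ − 2Aζ(2)) + 2 + O(m). -/

import Mathlib

open ArithmeticFunction

/-- The set `F_{1/m}` of fractions extracted from Ford circles by the line `y = x/m`:
rationals `x` with `0 ≤ x ≤ 1` whose reduced numerator times reduced denominator
is at most `m`. -/
def fordFracs (m : ℕ) : Set ℚ := {x : ℚ | 0 ≤ x ∧ x ≤ 1 ∧ x.num * x.den ≤ m}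

/-- The pairs of positive integers with product at most `n`. -/
def hyperbolaPairs (n : ℕ) : Finset (ℕ × ℕ) :=
  {p ∈ Finset.Icc 1 n ×ˢ Finset.Icc 1 n | p.1 * p.2 ≤ n}

lemma mem_hyperbolaPairs {n : ℕ} {p : ℕ × ℕ} :
    p ∈ hyperbolaPairs n ↔ 1 ≤ p.1 ∧ 1 ≤ p.2 ∧ p.1 * p.2 ≤ n := by
  simp only [hyperbolaPairs, Finset.mem_filter, Finset.mem_product, Finset.mem_Icc]
  constructor
  · tauto
  · rintro ⟨h1, h2, h3⟩
    exact ⟨⟨⟨h1, (Nat.le_mul_of_pos_right _ h2).trans h3⟩,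
      ⟨h2, (Nat.le_mul_of_pos_left _ h1).trans h3⟩⟩, h3⟩

lemma card_hyperbolaPairs (n : ℕ) :
    (hyperbolaPairs n).card = ∑ k ∈ Finset.Icc 1 n, n / k := by
  rw [hyperbolaPairs, Finset.card_filter, Finset.sum_product]
  refine Finset.sum_congr rfl fun k hk => ?_
  have hk := (Finset.mem_Icc.1 hk).1
  rw [← Finset.card_filter]
  have : {j ∈ Finset.Icc 1 n | k * j ≤ n} = Finset.Icc 1 (n / k) := by
    ext j
    simp only [Finset.mem_filter, Finset.mem_Icc, Nat.le_div_iff_mul_le hk, mul_comm j k]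
    constructor
    · tauto
    · rintro ⟨h1, h2⟩
      exact ⟨⟨h1, (Nat.le_mul_of_pos_left _ hk).trans h2⟩, h2⟩
  rw [this, Nat.card_Icc, Nat.add_sub_cancel]

lemma card_hyperbolaPairs_filter_dvd {d : ℕ} (hd : 0 < d) (m : ℕ) :
    {p ∈ hyperbolaPairs m | d ∣ p.1 ∧ d ∣ p.2}.card = (hyperbolaPairs (m / d ^ 2)).card := by
  symm
  refine Finset.card_bij (fun p _ => (d * p.1, d * p.2)) ?_ ?_ ?_
  · intro p hp
    obtain ⟨h1, h2, h3⟩ := mem_hyperbolaPairs.1 hp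
    rw [Nat.le_div_iff_mul_le (by positivity)] at h3
    refine Finset.mem_filter.2 ⟨mem_hyperbolaPairs.2 ⟨Nat.mul_pos hd h1, Nat.mul_pos hd h2, ?_⟩,
      dvd_mul_right _ _, dvd_mul_right _ _⟩
    calc d * p.1 * (d * p.2) = p.1 * p.2 * d ^ 2 := by ring
      _ ≤ m := h3
  · rintro ⟨a, b⟩ _ ⟨a', b'⟩ _ h
    simpa [hd.ne'] using h
  · rintro ⟨a, b⟩ h
    obtain ⟨h, ⟨a, rfl⟩, ⟨b, rfl⟩⟩ := Finset.mem_filter.1 h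
    obtain ⟨h1, h2, h3⟩ := mem_hyperbolaPairs.1 h
    refine ⟨(a, b), mem_hyperbolaPairs.2
      ⟨Nat.pos_of_mul_pos_left h1, Nat.pos_of_mul_pos_left h2, ?_⟩, rfl⟩
    rw [Nat.le_div_iff_mul_le (by positivity)]
    calc a * b * d ^ 2 = d * a * (d * b) := by ring
      _ ≤ m := h3

lemma sum_divisors_moebius {n : ℕ} : ∑ d ∈ n.divisors, moebius d = if n = 1 then 1 else 0 := by
  rw [← coe_mul_zeta_apply, moebius_mul_coe_zeta, one_apply]

lemma card_coprime_hyperbolaPairs (m : ℕ) :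
    ({p ∈ hyperbolaPairs m | p.1.Coprime p.2}.card : ℤ) =
      ∑ d ∈ Finset.Icc 1 m, moebius d * (hyperbolaPairs (m / d ^ 2)).card := by
  have key : ∀ p ∈ hyperbolaPairs m, (if p.1.Coprime p.2 then (1 : ℤ) else 0) =
      ∑ d ∈ Finset.Icc 1 m, if d ∣ p.1 ∧ d ∣ p.2 then moebius d else 0 := by
    intro p hp
    obtain ⟨h1, h2, h3⟩ := mem_hyperbolaPairs.1 hp
    simp only [Nat.coprime_iff_gcd_eq_one]
    rw [← Finset.sum_filter, ← sum_divisors_moebius]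
    refine Finset.sum_congr ?_ fun _ _ => rfl
    ext d
    simp only [Nat.mem_divisors, Finset.mem_filter, Finset.mem_Icc, Nat.dvd_gcd_iff]
    constructor
    · rintro ⟨⟨ha, hb⟩, -⟩
      exact ⟨⟨Nat.pos_of_dvd_of_pos ha h1, (Nat.le_of_dvd h1 ha).trans
        ((Nat.le_mul_of_pos_right _ h2).trans h3)⟩, ha, hb⟩
    · rintro ⟨-, h⟩
      exact ⟨h, (Nat.gcd_pos_of_pos_left _ h1).ne'⟩
  rw [Finset.card_filter, Nat.cast_sum]
  simp only [Nat.cast_ite, Nat.cast_one, Nat.cast_zero]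
  rw [Finset.sum_congr rfl key, Finset.sum_comm]
  refine Finset.sum_congr rfl fun d hd => ?_
  rw [← card_hyperbolaPairs_filter_dvd (Finset.mem_Icc.1 hd).1, ← Finset.sum_filter,
    Finset.sum_const, nsmul_eq_mul, mul_comm]

lemma two_mul_card_coprime_le_hyperbolaPairs {m : ℕ} (hm : 0 < m) :
    2 * {p ∈ hyperbolaPairs m | p.1.Coprime p.2 ∧ p.1 ≤ p.2}.card =
      {p ∈ hyperbolaPairs m | p.1.Coprime p.2}.card + 1 := by
  set S := {p ∈ hyperbolaPairs m | p.1.Coprime p.2}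
  have h1 : {p ∈ hyperbolaPairs m | p.1.Coprime p.2 ∧ p.1 ≤ p.2} = {p ∈ S | p.1 ≤ p.2} := by
    rw [Finset.filter_filter]
  have h2 : {p ∈ S | p.1 ≤ p.2}.card = {p ∈ S | p.2 ≤ p.1}.card := by
    refine Finset.card_bij (fun p _ => p.swap) ?_ (fun _ _ _ _ h => Prod.swap_injective h) ?_
    all_goals
      rintro ⟨a, b⟩ h
      simp only [S, Finset.mem_filter, mem_hyperbolaPairs] at h
    · simp only [S, Finset.mem_filter, mem_hyperbolaPairs, Prod.swap]
      rw [mul_comm, Nat.coprime_comm]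
      tauto
    · refine ⟨(b, a), ?_, rfl⟩
      simp only [S, Finset.mem_filter, mem_hyperbolaPairs]
      rw [mul_comm, Nat.coprime_comm]
      tauto
  have h3 : {p ∈ S | p.1 ≤ p.2} ∪ {p ∈ S | p.2 ≤ p.1} = S := by
    rw [← Finset.filter_or, Finset.filter_true_of_mem fun p _ => le_total _ _]
  have h4 : {p ∈ S | p.1 ≤ p.2} ∩ {p ∈ S | p.2 ≤ p.1} = {(1, 1)} := by
    rw [← Finset.filter_and]
    ext ⟨a, b⟩
    simp only [S, Finset.mem_filter, mem_hyperbolaPairs, Finset.mem_singleton, Prod.mk.injEq]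
    constructor
    · rintro ⟨⟨-, h⟩, h', h''⟩
      obtain rfl := le_antisymm h' h''
      simpa using h
    · rintro ⟨rfl, rfl⟩
      simpa using Nat.succ_le_of_lt hm
  have := Finset.card_union_add_card_inter {p ∈ S | p.1 ≤ p.2} {p ∈ S | p.2 ≤ p.1}
  rw [h3, h4, Finset.card_singleton] at this
  rw [h1]
  omega

lemma ncard_fordFracs (m : ℕ) :
    (fordFracs m).ncard = {p ∈ hyperbolaPairs m | p.1.Coprime p.2 ∧ p.1 ≤ p.2}.card + 1 := by
  have hinj : Set.InjOn (fun x : ℚ => (x.num.toNat, x.den)) (fordFracs m) := by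
    rintro x ⟨hx, -, -⟩ y ⟨hy, -, -⟩ h
    have hx := Rat.num_nonneg.2 hx
    have hy := Rat.num_nonneg.2 hy
    simp only [Prod.mk.injEq] at h
    exact Rat.ext (by omega) h.2
  have himage : (fun x : ℚ => (x.num.toNat, x.den)) '' fordFracs m =
      (insert (0, 1) {p ∈ hyperbolaPairs m | p.1.Coprime p.2 ∧ p.1 ≤ p.2} : Finset (ℕ × ℕ)) := by
    ext ⟨a, b⟩
    simp only [Set.mem_image, Prod.mk.injEq, Finset.coe_insert, Set.mem_insert_iff,
      Finset.mem_coe, Finset.mem_filter, mem_hyperbolaPairs]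
    constructor
    · rintro ⟨x, ⟨h0, h1, h2⟩, rfl, rfl⟩
      rcases h0.eq_or_lt with rfl | h0
      · simp
      · right
        have hnum := Rat.num_pos.2 h0
        have hcop := x.reduced
        obtain ⟨n, hn⟩ := Int.eq_ofNat_of_zero_le hnum.le
        rw [hn] at hnum hcop h2 ⊢
        have hle : x.num ≤ x.den := by
          rw [← Rat.num_div_den x, div_le_one (by exact_mod_cast x.pos)] at h1
          exact_mod_cast h1
        rw [hn] at hle
        simp only [Int.natAbs_natCast] at hcop
        refine ⟨⟨by simpa [Nat.one_le_iff_ne_zero, Nat.pos_iff_ne_zero] using hnum, x.pos, ?_⟩, by simpa using hcop, by simpa using hle⟩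
        simpa using (by exact_mod_cast h2 : n * x.den ≤ m)
    · rintro (⟨rfl, rfl⟩ | ⟨⟨ha, hb, hab⟩, hcop, hle⟩)
      · exact ⟨0, by simp [fordFracs], by simp, by simp⟩
      · have hnum : ((a : ℚ) / b).num = a := by
          simpa using Rat.num_div_eq_of_coprime (a := a) (b := b) (by exact_mod_cast hb)
            (by simpa using hcop)
        have hden : ((a : ℚ) / b).den = b := by
          have := Rat.den_div_eq_of_coprime (a := a) (b := b) (by exact_mod_cast hb)
            (by simpa using hcop)
          simpa using this
        refine ⟨a / b, ⟨by positivity, ?_, ?_⟩, by simp [hnum], hden⟩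
        · rw [div_le_one (by exact_mod_cast hb)]
          exact_mod_cast hle
        · rw [hnum, hden]
          exact_mod_cast hab
  rw [← hinj.ncard_image, himage, Set.ncard_coe_finset, Finset.card_insert_of_notMem]
  simp [mem_hyperbolaPairs]

lemma abs_card_hyperbolaPairs_sub_mul_log_le {n : ℕ} {x : ℝ} (hx : 1 ≤ x) (hnx : n ≤ x)
    (hxn : x < n + 1) : |((hyperbolaPairs n).card : ℝ) - x * Real.log x| ≤ 2 * x := by
  have hlog : 0 ≤ Real.log x := Real.log_nonneg hx
  have hlogx : Real.log x ≤ x := Real.log_le_self (by linarith)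
  have hH : ((harmonic n : ℚ) : ℝ) = ∑ k ∈ Finset.Icc 1 n, (k : ℝ)⁻¹ := by
    simp [harmonic_eq_sum_Icc]
  have hn1 : (1 : ℝ) ≤ n := by
    have : (0 : ℝ) < n := by linarith
    exact_mod_cast this
  have hupper : ((hyperbolaPairs n).card : ℝ) ≤ n * (harmonic n : ℚ) := by
    rw [card_hyperbolaPairs, hH, Finset.mul_sum, Nat.cast_sum]
    exact Finset.sum_le_sum fun k _ => Nat.cast_div_le
  have hlower : n * ((harmonic n : ℚ) : ℝ) - n ≤ (hyperbolaPairs n).card := by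
    rw [card_hyperbolaPairs, hH, Finset.mul_sum, Nat.cast_sum, sub_le_iff_le_add]
    calc ∑ k ∈ Finset.Icc 1 n, (n : ℝ) * (k : ℝ)⁻¹
        ≤ ∑ k ∈ Finset.Icc 1 n, (((n / k : ℕ) : ℝ) + 1) := by
          refine Finset.sum_le_sum fun k hk => ?_
          have := Nat.lt_floor_add_one ((n : ℝ) / k)
          rw [Nat.floor_div_eq_div] at this
          exact this.le
      _ = _ := by simp [Finset.sum_add_distrib]
  have h1 := harmonic_le_one_add_log n
  have h2 := log_add_one_le_harmonic n
  push_cast at h2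
  have h3 : Real.log x ≤ Real.log (n + 1) := Real.log_le_log (by linarith) hxn.le
  have h4 : Real.log n ≤ Real.log x := Real.log_le_log (by linarith) hnx
  rw [abs_le]
  constructor
  · have : n * Real.log x ≤ n * ((harmonic n : ℚ) : ℝ) := by gcongr; linarith
    nlinarith
  · have : n * ((harmonic n : ℚ) : ℝ) ≤ x * (1 + Real.log x) := by
      have h5 := h1.trans (add_le_add_right h4 1)
      have h6 : 0 ≤ Real.log ((n : ℝ) + 1) := hlog.trans h3
      exact mul_le_mul hnx h5 (h6.trans h2) (by linarith)
    linarith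

lemma abs_card_hyperbolaPairs_div_sq_sub_le {m d : ℕ} (hm : 0 < m) (hd : 0 < d) :
    |((hyperbolaPairs (m / d ^ 2)).card : ℝ) - m / d ^ 2 * Real.log m| ≤
      m * ((2 + 2 * Real.log d) / d ^ 2) := by
  have hm' : (0 : ℝ) < m := by exact_mod_cast hm
  have hd' : (0 : ℝ) < d := by exact_mod_cast hd
  have hlogm : 0 ≤ Real.log m := Real.log_natCast_nonneg m
  rcases le_or_gt (d ^ 2) m with h | h
  · have hx : (1 : ℝ) ≤ m / d ^ 2 := by
      rw [one_le_div (by positivity)]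
      exact_mod_cast h
    have hfl : ⌊(m : ℝ) / d ^ 2⌋₊ = m / d ^ 2 := by
      exact_mod_cast Nat.floor_div_eq_div (K := ℝ) m (d ^ 2)
    have := abs_card_hyperbolaPairs_sub_mul_log_le (n := m / d ^ 2) hx
      (hfl ▸ Nat.floor_le (by positivity)) (hfl ▸ Nat.lt_floor_add_one _)
    rw [Real.log_div hm'.ne' (by positivity), Real.log_pow] at this
    have hlogd : 0 ≤ (m : ℝ) / d ^ 2 * (2 * Real.log d) :=
      mul_nonneg (by positivity) (mul_nonneg two_pos.le (Real.log_natCast_nonneg d))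
    have e : (m : ℝ) * ((2 + 2 * Real.log d) / d ^ 2) =
      2 * (m / d ^ 2) + m / d ^ 2 * (2 * Real.log d) := by ring
    rw [e]
    rw [abs_le] at this ⊢
    push_cast at this
    constructor <;> linarith
  · have hlog : Real.log m ≤ 2 * Real.log d := by
      rw [← Nat.cast_two, ← Real.log_pow]
      exact Real.log_le_log hm' (by exact_mod_cast h.le)
    rw [Nat.div_eq_of_lt h]
    simp only [hyperbolaPairs, Finset.Icc_eq_empty_of_lt Nat.zero_lt_one, Finset.empty_product,
      Finset.filter_empty, Finset.card_empty, Nat.cast_zero, zero_sub, abs_neg]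
    rw [abs_of_nonneg (by positivity), div_mul_eq_mul_div, mul_div_assoc]
    gcongr
    linarith

lemma summable_log_div_sq : Summable fun d : ℕ => (2 + 2 * Real.log d) / (d : ℝ) ^ 2 := by
  have h : Summable fun d : ℕ => 2 * ((d : ℝ) ^ (-2 : ℝ)) + 4 * (d : ℝ) ^ (-(3 / 2) : ℝ) :=
    ((Real.summable_nat_rpow.2 (by norm_num)).mul_left _).add
      ((Real.summable_nat_rpow.2 (by norm_num)).mul_left _)
  refine h.of_nonneg_of_le (fun d => ?_) fun d => ?_
  · have := Real.log_natCast_nonneg d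
    positivity
  · rcases Nat.eq_zero_or_pos d with rfl | hd
    · simp
    have hd' : (0 : ℝ) < d := by exact_mod_cast hd
    have hlog := Real.log_le_rpow_div hd'.le (ε := 1 / 2) (by norm_num)
    have e1 : (d : ℝ) ^ (-2 : ℝ) = 1 / (d : ℝ) ^ 2 := by
      rw [Real.rpow_neg hd'.le, one_div]; norm_cast
    have e2 : (d : ℝ) ^ (-(3 / 2) : ℝ) = (d : ℝ) ^ (1 / 2 : ℝ) / (d : ℝ) ^ 2 := by
      rw [← Real.rpow_natCast, ← Real.rpow_sub hd']; norm_num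
    rw [e1, e2, mul_one_div, ← mul_div_assoc, ← add_div]
    refine div_le_div_of_nonneg_right ?_ (by positivity)
    linarith

lemma hasSum_moebius_div_sq :
    HasSum (fun d : ℕ => (moebius d : ℝ) / (d : ℝ) ^ 2) (6 / Real.pi ^ 2) := by
  have h2 : (1 : ℝ) < (2 : ℂ).re := by norm_num
  have hs : LSeriesHasSum (fun n => (moebius n : ℂ)) 2 (LSeries (fun n => (moebius n : ℂ)) 2) :=
    (LSeriesSummable_moebius_iff.2 h2).LSeriesHasSum
  have hval : LSeries (fun n => (moebius n : ℂ)) 2 = ((6 / Real.pi ^ 2 : ℝ) : ℂ) := by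
    have := LSeries_zeta_mul_Lseries_moebius h2
    rw [LSeries_zeta_eq_riemannZeta h2, riemannZeta_two] at this
    have hpi : (Real.pi : ℂ) ≠ 0 := by exact_mod_cast Real.pi_ne_zero
    push_cast
    field_simp at this ⊢
    linear_combination this
  rw [hval, LSeriesHasSum] at hs
  rw [← Complex.hasSum_ofReal]
  convert hs using 2 with d
  rcases eq_or_ne d 0 with rfl | hd
  · simp
  · rw [LSeries.term_of_ne_zero hd]
    push_cast
    norm_cast

lemma abs_card_coprime_hyperbolaPairs_sub_le {m : ℕ} (hm : 0 < m) :
    |({p ∈ hyperbolaPairs m | p.1.Coprime p.2}.card : ℝ) - 6 / Real.pi ^ 2 * (m * Real.log m)| ≤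
      (m : ℝ) * ∑' d : ℕ, (2 + 2 * Real.log d) / (d : ℝ) ^ 2 := by
  have hS : HasSum (fun d : ℕ => (moebius d : ℝ) * (hyperbolaPairs (m / d ^ 2)).card)
      ({p ∈ hyperbolaPairs m | p.1.Coprime p.2}.card : ℝ) := by
    have : ({p ∈ hyperbolaPairs m | p.1.Coprime p.2}.card : ℝ) =
        ∑ d ∈ Finset.Icc 1 m, (moebius d : ℝ) * (hyperbolaPairs (m / d ^ 2)).card := by
      exact_mod_cast card_coprime_hyperbolaPairs m
    rw [this]
    refine hasSum_sum_of_ne_finset_zero fun d hd => ?_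
    rcases Nat.eq_zero_or_pos d with rfl | hd0
    · simp
    have hlt : m < d ^ 2 := by
      simp only [Finset.mem_Icc, not_and, not_le] at hd
      nlinarith [hd hd0]
    simp [Nat.div_eq_of_lt hlt, hyperbolaPairs]
  have hdiff := hS.sub (hasSum_moebius_div_sq.mul_right (m * Real.log m))
  rw [← Real.norm_eq_abs, ← hdiff.tsum_eq]
  refine tsum_of_norm_bounded (summable_log_div_sq.hasSum.mul_left _) fun d => ?_
  rcases Nat.eq_zero_or_pos d with rfl | hd
  · simp
  have hμ : |(moebius d : ℝ)| ≤ 1 := by exact_mod_cast abs_moebius_le_one (n := d)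
  calc ‖(moebius d : ℝ) * (hyperbolaPairs (m / d ^ 2)).card
        - moebius d / d ^ 2 * (m * Real.log m)‖
      = |(moebius d : ℝ)| *
          |((hyperbolaPairs (m / d ^ 2)).card : ℝ) - m / d ^ 2 * Real.log m| := by
        rw [Real.norm_eq_abs, ← abs_mul]
        ring_nf
    _ ≤ 1 * |((hyperbolaPairs (m / d ^ 2)).card : ℝ) - m / d ^ 2 * Real.log m| := by gcongr
    _ ≤ _ := by
        rw [one_mul]
        exact abs_card_hyperbolaPairs_div_sq_sub_le hm hd

/-- There is a constant `K > 0` such that for every integer `m ≥ 2`,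
`||F_{1/m}| - ((3/π²) m (ln m + 1 + 2γ) - A m + 2)| ≤ K m`, where `γ` is the
Euler–Mascheroni constant and `A = ∑_{n≥1} μ(n) ln(n)/n²`; that is,
`|F_{1/m}| = (m/(2 ζ(2))) (ln m + 1 + 2γ - 2 A ζ(2)) + 2 + O(m)`. -/
theorem card_fordFracs_first_approximation :
    ∃ K : ℝ, 0 < K ∧ ∀ m : ℕ, 2 ≤ m →
      |((fordFracs m).ncard : ℝ) -
          ((3 / Real.pi ^ 2) * m * (Real.log m + 1 + 2 * Real.eulerMascheroniConstant) -
            (∑' n : ℕ, (moebius n : ℝ) * Real.log n / n ^ 2) * m + 2)| ≤ K * m := by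
  set A := ∑' n : ℕ, (moebius n : ℝ) * Real.log n / n ^ 2
  set B := ∑' d : ℕ, (2 + 2 * Real.log d) / (d : ℝ) ^ 2
  set C := A - 3 / Real.pi ^ 2 * (1 + 2 * Real.eulerMascheroniConstant)
  have hB : 0 ≤ B := tsum_nonneg fun d => by
    have := Real.log_natCast_nonneg d
    positivity
  refine ⟨B + |C| + 1, by positivity, fun m hm => ?_⟩
  have hm' : (2 : ℝ) ≤ m := by exact_mod_cast hm
  have h1 : (2 : ℝ) * {p ∈ hyperbolaPairs m | p.1.Coprime p.2 ∧ p.1 ≤ p.2}.card =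
      {p ∈ hyperbolaPairs m | p.1.Coprime p.2}.card + 1 := by
    exact_mod_cast two_mul_card_coprime_le_hyperbolaPairs (by omega : 0 < m)
  have h2 := abs_card_coprime_hyperbolaPairs_sub_le (by omega : 0 < m)
  rw [ncard_fordFracs]
  push_cast
  have e : ({p ∈ hyperbolaPairs m | p.1.Coprime p.2 ∧ p.1 ≤ p.2}.card : ℝ) + 1 -
      (3 / Real.pi ^ 2 * m * (Real.log m + 1 + 2 * Real.eulerMascheroniConstant) - A * m + 2) =
      (({p ∈ hyperbolaPairs m | p.1.Coprime p.2}.card : ℝ) - 6 / Real.pi ^ 2 * (m * Real.log m)) / 2 +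
        C * m - 1 / 2 := by
    simp only [C]
    linear_combination h1 / 2
  have h3 : |C * m| = |C| * m := by rw [abs_mul, Nat.abs_cast]
  have h4 := abs_le.1 h3.le
  have h5 := abs_le.1 h2
  have h6 : 0 ≤ m * B := by positivity
  rw [e, abs_le]
  constructor <;> linarith
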